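/- Let K be an algebraically closed field of characteristic 0 complete with respect to a non-trivial (possibly non-archimedean) absolute value and f ∈ K(z) a rational function of degree d > 1, and let δ > 0 be a constant as in the separation lemma for SAT(f) and C(f). Then sup_{n∈ℕ} sup { |Φ_{g_f}(f^n(c), c)| : c ∈ (⋃_{j=0}^{n−1} f^{−j}(C(f)∩SAT(f))) \ Fix(f^n) } ≤ −log δ + 2 sup_{𝖯¹} |g_f| < ∞. -/

import Mathlib

open Filter Set Asymptotics Topology
open scoped ENNReal

noncomputable section

/-- `elog t` is `log t` with values in `[-∞,∞) ⊆ EReal`; `elog t = ⊥` for `t ≤ 0`. -/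
def elog (t : ℝ) : EReal := if t ≤ 0 then (⊥ : EReal) else ((Real.log t : ℝ) : EReal)

/-- The dynamics, on the Berkovich projective line `B = 𝖯¹(K)`, of a rational function
`f ∈ K(z)` of degree `d > 1` over an algebraically closed field `K` that is complete with
respect to a non-trivial (possibly non-archimedean) absolute value, together with its
potential-theoretic apparatus: the classical projective line `P1 = ℙ¹(K)` (a dense subset
of `𝖯¹`), the generalized Hsia kernel `hsia = [·,·]_can` extending the normalized chordal
metric on `ℙ¹`, the multiplicities `fixMult n` of fixed points of `fⁿ` (the divisor
`[fⁿ = Id]`, of total mass `dⁿ + 1`), the multiplicities `critMult n` of critical points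
of `fⁿ` (of total mass `2dⁿ - 2`), the multipliers `multiplier n w = (fⁿ)'(w)` of fixed
points of `fⁿ`, the chordal derivative `sharp = f^#` extended continuously to `𝖯¹`
(vanishing exactly at the critical points of `f`), the equilibrium (canonical) measure
`μf = μ_f`, the dynamical Green function `gf = g_f` (the normalized weight with
`Δ g_f + Ω_can = μ_f` and `U_{g_f,μ_f} ≡ 0`), and the continuous extensions
`prox n = [fⁿ, Id]_can` of `z ↦ [fⁿ(z), z]`. -/
structure BerkovichRationalDynamics (K : Type*) [NontriviallyNormedField K]
    [IsAlgClosed K] [CompleteSpace K] where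
  /-- the Berkovich projective line `𝖯¹ = 𝖯¹(K)` -/
  B : Type
  [topB : TopologicalSpace B]
  [msB : MeasurableSpace B]
  [borelB : BorelSpace B]
  [cptB : CompactSpace B]
  [nonemptyB : Nonempty B]
  /-- the classical projective line `ℙ¹ = ℙ¹(K)`, a dense subset of `𝖯¹` -/
  P1 : Set B
  dense_P1 : Dense P1
  /-- the generalized Hsia kernel `[·,·]_can` on `𝖯¹`, extending the normalized chordal
  metric on `ℙ¹`; it vanishes iff the two points agree and are classical -/
  hsia : B → B → ℝ
  hsia_symm : ∀ x y, hsia x y = hsia y x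
  hsia_nonneg : ∀ x y, 0 ≤ hsia x y
  hsia_le_one : ∀ x y, hsia x y ≤ 1
  hsia_eq_zero_iff : ∀ x y, (hsia x y = 0 ↔ x = y ∧ x ∈ P1)
  /-- the rational function `f`, extended continuously to `𝖯¹` -/
  f : B → B
  f_cont : Continuous f
  f_maps_P1 : MapsTo f P1 P1
  f_preim_P1 : ∀ x, f x ∈ P1 → x ∈ P1
  /-- the degree `d > 1` of `f` -/
  d : ℕ
  one_lt_d : 1 < d
  /-- multiplicity of `w ∈ ℙ¹` as a root of `fⁿ = Id` -/
  fixMult : ℕ → B → ℕ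
  fixMult_pos_iff : ∀ n, 1 ≤ n → ∀ w, (0 < fixMult n w ↔ w ∈ P1 ∧ f^[n] w = w)
  fixMult_support_finite : ∀ n, (Function.support (fixMult n)).Finite
  fixMult_total : ∀ n, 1 ≤ n → ∑ᶠ w, fixMult n w = d ^ n + 1
  /-- multiplicity of `c ∈ ℙ¹` as a critical point of `fⁿ` -/
  critMult : ℕ → B → ℕ
  critMult_mem_P1 : ∀ n w, 0 < critMult n w → w ∈ P1
  critMult_support_finite : ∀ n, (Function.support (critMult n)).Finite
  critMult_total : ∀ n, 1 ≤ n → ∑ᶠ w, critMult n w = 2 * d ^ n - 2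
  critMult_iterate : ∀ n, 1 ≤ n → ∀ w,
    (0 < critMult n w ↔ ∃ j < n, 0 < critMult 1 (f^[j] w))
  /-- the multiplier `(fⁿ)'(w)` of a fixed point `w ∈ ℙ¹` of `fⁿ` -/
  multiplier : ℕ → B → K
  multiplier_chain : ∀ m n w, 1 ≤ m → m ∣ n → w ∈ P1 → f^[m] w = w →
    multiplier n w = multiplier m w ^ (n / m)
  multiplier_eq_zero_iff : ∀ n, 1 ≤ n → ∀ w, w ∈ P1 → f^[n] w = w →
    (multiplier n w = 0 ↔ 0 < critMult n w)
  /-- the chordal derivative `f^#`, extended continuously to `𝖯¹` -/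
  sharp : B → ℝ
  sharp_cont : Continuous sharp
  sharp_nonneg : ∀ x, 0 ≤ sharp x
  sharp_eq_zero_iff : ∀ x, (sharp x = 0 ↔ 0 < critMult 1 x)
  sharp_multiplier : ∀ n w, 1 ≤ n → w ∈ P1 → f^[n] w = w →
    ‖multiplier n w‖ = ∏ j ∈ Finset.range n, sharp (f^[j] w)
  /-- the equilibrium (canonical) measure `μ_f` of `f` on `𝖯¹` -/
  μf : MeasureTheory.Measure B
  μf_prob : MeasureTheory.IsProbabilityMeasure μf
  μf_invariant : μf.map f = μf
  μf_P1_point_null : ∀ z ∈ P1, μf {z} = 0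
  /-- the dynamical Green function `g_f` of `f` on `𝖯¹` -/
  gf : B → ℝ
  gf_cont : Continuous gf
  /-- `U_{g_f, μ_f} ≡ 0` on `𝖯¹` (normalization `V_{g_f} = 0` and `Δ g_f + Ω_can = μ_f`) -/
  gf_potential : ∀ x, ∫ y, (Real.log (hsia x y) - gf x - gf y) ∂μf = 0
  /-- the continuous extension `[fⁿ, Id]_can` to `𝖯¹` of `z ↦ [fⁿ(z), z]` -/
  prox : ℕ → B → ℝ
  prox_cont : ∀ n, Continuous (prox n)
  prox_eq : ∀ n, ∀ z ∈ P1, prox n z = hsia (f^[n] z) z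
  prox_eq_zero_iff : ∀ n, 1 ≤ n → ∀ x, (prox n x = 0 ↔ x ∈ P1 ∧ f^[n] x = x)
  /-- `log f^# ∈ L¹(μ_f)`, so that the Lyapunov exponent is in `(-∞,∞)` -/
  log_sharp_integrable : MeasureTheory.Integrable (fun x => Real.log (sharp x)) μf

open MeasureTheory

namespace BerkovichRationalDynamics

attribute [instance] topB msB borelB cptB nonemptyB

variable {K : Type*} [NontriviallyNormedField K] [IsAlgClosed K] [CompleteSpace K]
  (D : BerkovichRationalDynamics K)

/-- `Fix(fⁿ)`, the set of fixed points of `fⁿ` in `ℙ¹`. -/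
def Fix (n : ℕ) : Set D.B := {w | w ∈ D.P1 ∧ D.f^[n] w = w}

/-- `Fix*(fⁿ)`, the set of periodic points of `f` in `ℙ¹` of exact period `n`. -/
def FixStar (n : ℕ) : Set D.B := D.Fix n \ ⋃ m ∈ {m : ℕ | m ∣ n ∧ m < n}, D.Fix m

/-- `C(fⁿ)`, the set of critical points of `fⁿ` in `ℙ¹`. -/
def Crit (n : ℕ) : Set D.B := {w | 0 < D.critMult n w}

/-- `SAT(f) = ⋃_{n ≥ 1} (Fix(fⁿ) ∩ C(fⁿ))`, the set of superattracting periodic points. -/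
def SAT : Set D.B := ⋃ n ∈ {n : ℕ | 1 ≤ n}, D.Fix n ∩ D.Crit n

/-- the Lyapunov exponent `L(f) = ∫_{𝖯¹} log f^# dμ_f`. -/
def Lyap : ℝ := ∫ x, Real.log (D.sharp x) ∂D.μf

/-- the `g_f`-potential kernel `Φ_{g_f}(x,y) = log [x,y]_can - g_f(x) - g_f(y)`
(real-valued version, meaningful off the classical diagonal). -/
def PhiR (x y : D.B) : ℝ := Real.log (D.hsia x y) - D.gf x - D.gf y

/-- the `g_f`-potential kernel `Φ_{g_f}(x,y) = log [x,y]_can - g_f(x) - g_f(y)`,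
with values in `[-∞,∞)`. -/
def Phi (x y : D.B) : EReal := elog (D.hsia x y) - (D.gf x : EReal) - (D.gf y : EReal)

/-- the divisor `[fⁿ = Id] = ∑_{w : fⁿ(w) = w} δ_w`, counted with multiplicity,
as a measure on `𝖯¹`. -/
def fixMeasure (n : ℕ) : Measure D.B :=
  Measure.sum fun w : D.B => (D.fixMult n w : ℝ≥0∞) • Measure.dirac w

/-- `∫_{𝖯¹} Φ(fⁿ, Id)_{g_f} dμ_f`, the `μ_f`-average of the logarithmic proximity
function `Φ(fⁿ, Id)_{g_f} = log [fⁿ, Id]_can - g_f ∘ fⁿ - g_f` between `fⁿ` and `Id`. -/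
def proxInt (n : ℕ) : ℝ :=
  ∫ x, (Real.log (D.prox n x) - D.gf (D.f^[n] x) - D.gf x) ∂D.μf

end BerkovichRationalDynamics

/-- **Lemma 3.4**: with `δ > 0` as in the separation lemma (Lemma 3.3),
`sup_{n ∈ ℕ} sup {|Φ_{g_f}(fⁿ(c), c)| : c ∈ (⋃_{j<n} f⁻ʲ(C(f) ∩ SAT(f))) \ Fix(fⁿ)}`
` ≤ - log δ + 2 sup_{𝖯¹} |g_f| < ∞`. -/
theorem preperiodic_term_bounded {K : Type*} [NontriviallyNormedField K]
    [IsAlgClosed K] [CharZero K] [CompleteSpace K] (D : BerkovichRationalDynamics K)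
    (δ : ℝ) (hδ : 0 < δ)
    (hsep : ∀ a ∈ D.SAT, ∀ c ∈ D.Crit 1,
      (⋃ j : ℕ, D.f^[j] ⁻¹' {c}) ≠ {a} →
      ∀ w ∈ (⋃ j : ℕ, D.f^[j] ⁻¹' {c}) \ {a}, δ ≤ D.hsia a w)
    (hsep' : ∀ a ∈ D.SAT, ∀ c ∈ D.Crit 1,
      (⋃ j : ℕ, D.f^[j] ⁻¹' {c}) = {a} → a ∈ D.Fix 1) :
    ∀ n : ℕ, 1 ≤ n →
      ∀ c ∈ ((⋃ j ∈ Finset.range n, D.f^[j] ⁻¹' (D.Crit 1 ∩ D.SAT)) \ D.Fix n),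
        |D.PhiR (D.f^[n] c) c| ≤ - Real.log δ + 2 * ⨆ x : D.B, |D.gf x| := by
  intro n hn c hc
  obtain ⟨hc1, hc2⟩ := hc
  simp only [mem_iUnion, Finset.mem_range, mem_preimage] at hc1
  obtain ⟨j, hj, hcrit, hsat⟩ := hc1
  have hsat0 := hsat
  simp only [BerkovichRationalDynamics.SAT, mem_iUnion, mem_setOf_eq] at hsat0
  obtain ⟨m, hm, ⟨hP, hfix⟩, -⟩ := hsat0
  have hpre : ∀ k : ℕ, ∀ x : D.B, D.f^[k] x ∈ D.P1 → x ∈ D.P1 := by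
    intro k
    induction k with
    | zero => intro x hx; exact hx
    | succ k ih =>
      intro x hx
      rw [Function.iterate_succ_apply] at hx
      exact D.f_preim_P1 _ (ih _ hx)
  have hcP : c ∈ D.P1 := hpre j c hP
  have hne : D.f^[n] c ≠ c := fun h => hc2 ⟨hcP, h⟩
  have hper : Function.IsPeriodicPt D.f m (D.f^[j] c) := hfix
  have hnc : D.f^[n] c = D.f^[n - j] (D.f^[j] c) := by
    rw [← Function.iterate_add_apply]; congr 2; omega
  have hA : D.f^[n] c ∈ D.SAT := by
    simp only [BerkovichRationalDynamics.SAT, mem_iUnion, mem_setOf_eq]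
    refine ⟨m, hm, ⟨?_, ?_⟩, ?_⟩
    · rw [hnc]; exact D.f_maps_P1.iterate _ hP
    · rw [hnc]; exact hper.apply_iterate (n - j)
    · refine (D.critMult_iterate m hm _).2 ⟨(m - (n - j) % m) % m, Nat.mod_lt _ hm, ?_⟩
      have h0 : D.f^[(m - (n - j) % m) % m] (D.f^[n] c) = D.f^[j] c := by
        rw [hnc, ← Function.iterate_add_apply]
        have hd : m ∣ (m - (n - j) % m) % m + (n - j) := by
          have h1 : (n - j) % m < m := Nat.mod_lt _ hm
          apply Nat.dvd_of_mod_eq_zero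
          rw [Nat.mod_add_mod, ← Nat.add_mod_mod, Nat.sub_add_cancel h1.le, Nat.mod_self]
        exact (hper.trans_dvd hd)
      rw [h0]; exact hcrit
  have hmem : c ∈ (⋃ i : ℕ, D.f^[i] ⁻¹' {D.f^[j] c}) := mem_iUnion.2 ⟨j, rfl⟩
  have hd : δ ≤ D.hsia (D.f^[n] c) c := by
    refine hsep _ hA _ hcrit ?_ c ⟨hmem, fun h => hne (Eq.symm h)⟩
    intro h
    rw [h] at hmem
    exact hne (Eq.symm hmem)
  have hbdd : BddAbove (range fun x : D.B => |D.gf x|) :=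
    (isCompact_range D.gf_cont.abs).bddAbove
  have g1 := abs_le.1 (le_ciSup hbdd (D.f^[n] c))
  have g2 := abs_le.1 (le_ciSup hbdd c)
  have l1 := Real.log_le_log hδ hd
  have l2 := Real.log_nonpos (D.hsia_nonneg _ _) (D.hsia_le_one (D.f^[n] c) c)
  unfold BerkovichRationalDynamics.PhiR
  rw [abs_le]
  constructor <;> linarith [g1.1, g1.2, g2.1, g2.2]
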